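/- Let S, T and U be standard Borel spaces. Let ν be a finite measure on S × U with projection ν̂ = ν ∘ (projection onto S)⁻¹, let κ⁺, κ⁻ be bounded kernels from S × U to T, and let κ̂⁺, κ̂⁻ be bounded kernels from S to T, such that the image of the signed measure (ν ⊗ κ⁺) − (ν ⊗ κ⁻) under the map ((s,u),t) ↦ (s,t) equals (ν̂ ⊗ κ̂⁺) − (ν̂ ⊗ κ̂⁻). Then for ν̂-almost every s ∈ S, ‖κ̂⁺_s − κ̂⁻_s‖ ≤ sup_{u∈U} ‖κ⁺_{(s,u)} − κ⁻_{(s,u)}‖. -/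

import Mathlib

open MeasureTheory ProbabilityTheory
open scoped ENNReal

/-- The total variation distance between two finite measures. -/
noncomputable def tvDist {T : Type*} [MeasurableSpace T] (α β : Measure T)
    [IsFiniteMeasure α] [IsFiniteMeasure β] : ℝ≥0∞ :=
  (α.toSignedMeasure - β.toSignedMeasure).totalVariation Set.univ

lemma tv_aux {T : Type*} [MeasurableSpace T] (α β : Measure T)
    [IsFiniteMeasure α] [IsFiniteMeasure β] :
    ∃ p n : Measure T, IsFiniteMeasure p ∧ IsFiniteMeasure n ∧
      tvDist α β = p Set.univ + n Set.univ ∧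
      (∀ A, MeasurableSet A → α A + n A = β A + p A) ∧
      ∃ A, MeasurableSet A ∧ n A = 0 ∧ p Aᶜ = 0 := by
  set σ := α.toSignedMeasure - β.toSignedMeasure with hσ
  set j := σ.toJordanDecomposition with hj
  refine ⟨j.posPart, j.negPart, inferInstance, inferInstance, rfl, ?_, ?_⟩
  · intro A hA
    have h1 := σ.apply_eq_posPart_real_sub_negPart_real hA
    rw [hσ, Measure.toSignedMeasure_sub_apply hA, ← hσ, ← hj] at h1
    have h2 : α.real A + j.negPart.real A = β.real A + j.posPart.real A := by linarith
    simp only [measureReal_def] at h2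
    rw [← ENNReal.toReal_add (measure_ne_top _ _) (measure_ne_top _ _),
      ← ENNReal.toReal_add (measure_ne_top _ _) (measure_ne_top _ _)] at h2
    exact (ENNReal.toReal_eq_toReal_iff' (by simp) (by simp)).1 h2
  · obtain ⟨A, hA, h1, h2⟩ := j.mutuallySingular
    exact ⟨Aᶜ, hA.compl, h2, by simpa using h1⟩

lemma tv_le {T : Type*} [MeasurableSpace T] (α β : Measure T)
    [IsFiniteMeasure α] [IsFiniteMeasure β] (A : Set T) (hA : MeasurableSet A) :
    α A + β Aᶜ ≤ β A + α Aᶜ + tvDist α β := by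
  obtain ⟨p, n, _, _, h, h1, -⟩ := tv_aux α β
  rw [h]
  calc α A + β Aᶜ ≤ (α A + n A) + (β Aᶜ + p Aᶜ) := by gcongr <;> exact le_self_add
    _ = β A + α Aᶜ + (p A + n Aᶜ) := by
      rw [h1 A hA, ← h1 Aᶜ hA.compl]; ring
    _ ≤ _ := by gcongr <;> exact Set.subset_univ _

lemma tv_exists {T : Type*} [MeasurableSpace T] (α β : Measure T)
    [IsFiniteMeasure α] [IsFiniteMeasure β] :
    ∃ A, MeasurableSet A ∧ tvDist α β + (β A + α Aᶜ) = α A + β Aᶜ := by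
  obtain ⟨p, n, _, _, h, h1, A, hA, hn, hp⟩ := tv_aux α β
  refine ⟨A, hA, ?_⟩
  have e1 := h1 A hA
  have e2 := h1 Aᶜ hA.compl
  rw [hn, add_zero] at e1
  rw [hp, add_zero] at e2
  rw [h, ← measure_add_measure_compl hA, ← measure_add_measure_compl (μ := n) hA, hn, hp, e1, ← e2]
  ring

/-- Projection property of signed kernels: if the image of `(ν ⊗ κ⁺) − (ν ⊗ κ⁻)` under
`((s,u),t) ↦ (s,t)` equals `(ν̂ ⊗ κ̂⁺) − (ν̂ ⊗ κ̂⁻)`, where `ν̂` is the projection of `ν`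
onto `S`, then `‖κ̂⁺_s − κ̂⁻_s‖ ≤ sup_u ‖κ⁺_{(s,u)} − κ⁻_{(s,u)}‖` for `ν̂`-a.e. `s`. -/
theorem stmt_16 {S T U : Type*} [MeasurableSpace S] [StandardBorelSpace S]
    [MeasurableSpace T] [StandardBorelSpace T] [MeasurableSpace U] [StandardBorelSpace U]
    (ν : Measure (S × U)) [IsFiniteMeasure ν]
    (νhat : Measure S) [IsFiniteMeasure νhat] (hνhat : νhat = ν.map Prod.fst)
    (κp κm : Kernel (S × U) T) [IsFiniteKernel κp] [IsFiniteKernel κm]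
    (κhp κhm : Kernel S T) [IsFiniteKernel κhp] [IsFiniteKernel κhm]
    (hproj : ((ν ⊗ₘ κp).toSignedMeasure - (ν ⊗ₘ κm).toSignedMeasure).map
        (fun q : (S × U) × T => (q.1.1, q.2)) =
      (νhat ⊗ₘ κhp).toSignedMeasure - (νhat ⊗ₘ κhm).toSignedMeasure) :
    ∀ᵐ s ∂νhat, tvDist (κhp s) (κhm s) ≤ ⨆ u : U, tvDist (κp (s, u)) (κm (s, u)) := by
  rcases isEmpty_or_nonempty U with hU | hU
  · have : ν = 0 := Measure.eq_zero_of_isEmpty ν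
    subst this
    simp [hνhat]
  have hfst : ν.fst = νhat := hνhat.symm
  let η : Kernel S (S × U) := Kernel.id ×ₖ ν.condKernel
  have hν : νhat ⊗ₘ ν.condKernel = ν := by rw [← hfst]; exact ν.disintegrate ν.condKernel
  have hmap : Measurable (fun q : (S × U) × T => (q.1.1, q.2)) := by fun_prop
  have key : ∀ (κ : Kernel (S × U) T) [IsFiniteKernel κ],
      (ν ⊗ₘ κ).map (fun q : (S × U) × T => (q.1.1, q.2)) = νhat ⊗ₘ (κ ∘ₖ η) := by
    intro κ _
    ext B hB
    have hB' := hmap hB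
    rw [Measure.map_apply hmap hB, Measure.compProd_apply hB', Measure.compProd_apply hB]
    have hm : Measurable fun a : S × U => κ a (Prod.mk a ⁻¹'
        ((fun q : (S × U) × T => (q.1.1, q.2)) ⁻¹' B)) :=
      Kernel.measurable_kernel_prodMk_left hB'
    conv_lhs => rw [← hν]
    rw [Measure.lintegral_compProd hm]
    refine lintegral_congr fun s => ?_
    have hBs : MeasurableSet (Prod.mk s ⁻¹' B) := measurable_prodMk_left hB
    rw [Kernel.comp_apply' _ _ _ hBs, Kernel.prod_apply, Kernel.id_apply,
      Measure.dirac_prod, lintegral_map (κ.measurable_coe hBs) measurable_prodMk_left]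
    rfl
  have hae : ∀ᵐ s ∂νhat, (κp ∘ₖ η + κhm) s = (κm ∘ₖ η + κhp) s := by
    apply Kernel.ae_eq_of_compProd_eq
    rw [Measure.compProd_add_right, Measure.compProd_add_right, ← key, ← key]
    ext B hB
    have h := congrArg (fun σ => σ B) hproj
    rw [VectorMeasure.map_apply _ hmap hB, Measure.toSignedMeasure_sub_apply (hmap hB),
      Measure.toSignedMeasure_sub_apply hB] at h
    rw [Measure.add_apply, Measure.add_apply, Measure.map_apply hmap hB,
      Measure.map_apply hmap hB]
    have h2 := sub_eq_sub_iff_add_eq_add.1 h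
    simp only [measureReal_def] at h2
    rw [← ENNReal.toReal_add (measure_ne_top _ _) (measure_ne_top _ _),
      ← ENNReal.toReal_add (measure_ne_top _ _) (measure_ne_top _ _)] at h2
    rw [(ENNReal.toReal_eq_toReal_iff' (by simp) (by simp)).1 h2, add_comm]
  filter_upwards [hae] with s hs
  set D := ⨆ u : U, tvDist (κp (s, u)) (κm (s, u)) with hD
  obtain ⟨A, hA, hAe⟩ := tv_exists (κhp s) (κhm s)
  have hs' : ∀ B, (κp ∘ₖ η) s B + κhm s B = (κm ∘ₖ η) s B + κhp s B := by
    intro B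
    have := congrArg (fun μ => μ B) hs
    simpa using this
  have hcomp : ∀ (κ : Kernel (S × U) T) (B : Set T), MeasurableSet B →
      (κ ∘ₖ η) s B = ∫⁻ u, κ (s, u) B ∂(ν.condKernel s) := by
    intro κ B hB
    rw [Kernel.comp_apply' _ _ _ hB, Kernel.prod_apply, Kernel.id_apply,
      Measure.dirac_prod, lintegral_map (κ.measurable_coe hB) measurable_prodMk_left]
  have hmeas : ∀ (κ : Kernel (S × U) T) (B : Set T), MeasurableSet B →
      Measurable fun u => κ (s, u) B := fun κ B hB =>
    (κ.measurable_coe hB).comp measurable_prodMk_left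
  have hle : (κp ∘ₖ η) s A + (κm ∘ₖ η) s Aᶜ ≤ (κm ∘ₖ η) s A + (κp ∘ₖ η) s Aᶜ + D := by
    rw [hcomp _ _ hA, hcomp _ _ hA, hcomp _ _ hA.compl, hcomp _ _ hA.compl,
      ← lintegral_add_left (hmeas κp A hA), ← lintegral_add_left (hmeas κm A hA)]
    have : D = ∫⁻ _, D ∂(ν.condKernel s) := by simp
    rw [this, ← lintegral_add_right _ measurable_const]
    refine lintegral_mono fun u => ?_
    refine (tv_le (κp (s, u)) (κm (s, u)) A hA).trans ?_
    gcongr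
    exact le_iSup (fun u => tvDist (κp (s, u)) (κm (s, u))) u
  set c := κhm s A + κhp s Aᶜ + ((κm ∘ₖ η) s A + (κp ∘ₖ η) s Aᶜ) with hc
  have hctop : c ≠ ∞ := by simp [hc]
  rw [← ENNReal.add_le_add_iff_right hctop]
  calc tvDist (κhp s) (κhm s) + c
      = (tvDist (κhp s) (κhm s) + (κhm s A + κhp s Aᶜ)) +
          ((κm ∘ₖ η) s A + (κp ∘ₖ η) s Aᶜ) := by rw [hc]; ring
    _ = ((κm ∘ₖ η) s A + κhp s A) + ((κp ∘ₖ η) s Aᶜ + κhm s Aᶜ) := by rw [hAe]; ring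
    _ = ((κp ∘ₖ η) s A + (κm ∘ₖ η) s Aᶜ) + (κhm s A + κhp s Aᶜ) := by
      rw [← hs' A, hs' Aᶜ]; ring
    _ ≤ ((κm ∘ₖ η) s A + (κp ∘ₖ η) s Aᶜ + D) + (κhm s A + κhp s Aᶜ) := by gcongr
    _ = D + c := by rw [hc]; ring
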